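/- arXiv:2510.06960 — 3 statements merged into one kernel-verified Lean document; each statement's English description precedes it below -/
import Mathlib

section
/- Let f₀, f₁, f₂, … be nonnegative reals with ∑_k f_k convergent, and suppose the function g(t) = ∑_{k=0}^∞ f_k P_k^n(t) satisfies g(t) ≤ −1 for all t ∈ [−1, 1/2], where P_k^n are the normalized Gegenbauer polynomials with P_k^n(1) = 1. Then any set of N unit vectors in ℝ^n with pairwise inner products at most 1/2 satisfies N ≤ 1 + ∑_k f_k. (Delsarte–Goethals–Seidel linear programming bound for the kissing number.) -/
section
open MvPolynomial

/-- The Fischer (apolar) bilinear form on polynomials: monomials are orthogonal and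
`X ^ m` has squared norm `∏ i, (m i)!`. -/
noncomputable def fischerForm (σ : Type*) [Fintype σ] :
    MvPolynomial σ ℝ →ₗ[ℝ] MvPolynomial σ ℝ →ₗ[ℝ] ℝ :=
  (basisMonomials σ ℝ).constr ℝ fun m => (∏ i, ((m i).factorial : ℝ)) • lcoeff ℝ m

variable {σ : Type*} [Fintype σ]

lemma fischerForm_monomial (m : σ →₀ ℕ) (a : ℝ) (q : MvPolynomial σ ℝ) :
    fischerForm σ (monomial m a) q = a * ((∏ i, ((m i).factorial : ℝ)) * coeff m q) := by
  have h : monomial m a = a • basisMonomials σ ℝ m := by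
    simp [smul_monomial]
  rw [h, map_smul, fischerForm, Module.Basis.constr_basis]
  simp

lemma fischerForm_comm (p q : MvPolynomial σ ℝ) :
    fischerForm σ p q = fischerForm σ q p := by
  classical
  induction p using MvPolynomial.induction_on' with
  | monomial m a =>
    induction q using MvPolynomial.induction_on' with
    | monomial l b =>
      rw [fischerForm_monomial, fischerForm_monomial, coeff_monomial, coeff_monomial]
      by_cases h : m = l
      · subst h; simp; ring
      · simp [h, Ne.symm h]
    | add p q hp hq => simp only [map_add, LinearMap.add_apply, hp, hq]
  | add p q hp hq => simp only [map_add, LinearMap.add_apply, hp, hq]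

lemma fischerForm_self_nonneg (p : MvPolynomial σ ℝ) : 0 ≤ fischerForm σ p p := by
  have h : ∀ q, fischerForm σ p q =
      ∑ m ∈ p.support, coeff m p * ((∏ i, ((m i).factorial : ℝ)) * coeff m q) := by
    intro q
    conv_lhs => rw [p.as_sum]
    simp only [map_sum, LinearMap.sum_apply, fischerForm_monomial]
  rw [h]
  refine Finset.sum_nonneg fun m _ => ?_
  rw [mul_left_comm]
  exact mul_nonneg (Finset.prod_nonneg fun _ _ => by positivity) (mul_self_nonneg _)

lemma fischerForm_X_mul (i : σ) (p q : MvPolynomial σ ℝ) :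
    fischerForm σ (X i * p) q = fischerForm σ p (pderiv i q) := by
  classical
  induction p using MvPolynomial.induction_on' with
  | monomial m a =>
    rw [mul_comm, X, monomial_mul, mul_one, fischerForm_monomial, fischerForm_monomial,
      coeff_pderiv]
    have : ∏ j, (((m + Finsupp.single i 1 : σ →₀ ℕ) j).factorial : ℝ)
        = (∏ j, ((m j).factorial : ℝ)) * (m i + 1) := by
      rw [← Finset.mul_prod_erase _ _ (Finset.mem_univ i),
        ← Finset.mul_prod_erase _ (fun j => ((m j).factorial : ℝ)) (Finset.mem_univ i)]
      have : ∀ j ∈ Finset.univ.erase i, (((m + Finsupp.single i 1 : σ →₀ ℕ) j).factorial : ℝ)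
          = ((m j).factorial : ℝ) := by
        intro j hj
        simp [Finsupp.single_eq_of_ne (Finset.ne_of_mem_erase hj)]
      rw [Finset.prod_congr rfl this]
      simp [Nat.factorial_succ]
      ring
    rw [this]
    ring
  | add p q hp hq => simp only [mul_add, map_add, LinearMap.add_apply, hp, hq]

/-- The linear form `∑ i, y i * X i`. -/
noncomputable def linForm (y : σ → ℝ) : MvPolynomial σ ℝ := ∑ i, C (y i) * X i

variable (σ) in
/-- The squared Euclidean norm as a polynomial. -/
noncomputable def normSqPoly : MvPolynomial σ ℝ := ∑ i, X i * X i

/-- The Laplacian on polynomials. -/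
noncomputable def laplacian : MvPolynomial σ ℝ →ₗ[ℝ] MvPolynomial σ ℝ :=
  ∑ i, (pderiv (R := ℝ) i).toLinearMap ∘ₗ (pderiv i).toLinearMap

lemma laplacian_apply (p : MvPolynomial σ ℝ) : laplacian p = ∑ i, pderiv i (pderiv i p) := by
  simp [laplacian]

lemma fischerForm_normSqPoly_mul (p q : MvPolynomial σ ℝ) :
    fischerForm σ (normSqPoly σ * p) q = fischerForm σ p (laplacian q) := by
  simp only [normSqPoly, laplacian_apply, Finset.sum_mul, map_sum, LinearMap.sum_apply, mul_assoc,
    fischerForm_X_mul]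

lemma fischerForm_linForm_mul (y : σ → ℝ) (p q : MvPolynomial σ ℝ) :
    fischerForm σ (linForm y * p) q = fischerForm σ p (∑ i, C (y i) * pderiv i q) := by
  simp only [linForm, Finset.sum_mul, map_sum, LinearMap.sum_apply, C_mul',
    smul_mul_assoc, map_smul, LinearMap.smul_apply, fischerForm_X_mul]

lemma pderiv_linForm (i : σ) (y : σ → ℝ) : pderiv i (linForm y) = C (y i) := by
  classical
  simp [linForm, pderiv_X, Pi.single_apply]

lemma pderiv_normSqPoly (i : σ) : pderiv i (normSqPoly σ) = 2 * X i := by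
  classical
  simp [normSqPoly, pderiv_X, Pi.single_apply, Finset.sum_add_distrib, two_mul]

lemma laplacian_linForm_pow_mul (y : σ → ℝ) (m j : ℕ) :
    laplacian (linForm y ^ m * normSqPoly σ ^ j) =
      C ((m : ℝ) * (m - 1) * ∑ i, y i * y i) * (linForm y ^ (m - 2) * normSqPoly σ ^ j) +
      C ((2 * j : ℝ) * (2 * m + 2 * j - 2 + Fintype.card σ)) *
        (linForm y ^ m * normSqPoly σ ^ (j - 1)) := by
  have h2 : (C 2 : MvPolynomial σ ℝ) = 2 := map_ofNat C 2
  have h4 : (C 4 : MvPolynomial σ ℝ) = 4 := map_ofNat C 4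
  have key : ∀ i, pderiv i (pderiv i (linForm y ^ m * normSqPoly σ ^ j)) =
      C ((m : ℝ) * (m - 1)) * (linForm y ^ (m - 2) * normSqPoly σ ^ j) * C (y i * y i) +
      C (4 * m * j : ℝ) * (linForm y ^ (m - 1) * normSqPoly σ ^ (j - 1)) * (C (y i) * X i) +
      C (4 * j * (j - 1) : ℝ) * (linForm y ^ m * normSqPoly σ ^ (j - 2)) * (X i * X i) +
      C (2 * j : ℝ) * (linForm y ^ m * normSqPoly σ ^ (j - 1)) := by
    intro i
    have hd : pderiv i (2 : MvPolynomial σ ℝ) = 0 := by rw [← h2, pderiv_C]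
    rcases m with _ | _ | m <;> rcases j with _ | _ | j <;>
      simp [Derivation.leibniz, Derivation.leibniz_pow, pderiv_linForm, pderiv_normSqPoly,
        smul_eq_mul, nsmul_eq_mul, h2, h4, hd] <;> ring
  rw [laplacian_apply, Finset.sum_congr rfl fun i _ => key i]
  simp only [Finset.sum_add_distrib, ← Finset.mul_sum, Finset.sum_const, Finset.card_univ,
    ← map_sum]
  change _ + _ * linForm y + _ * normSqPoly σ + _ = _
  have hn : ∀ a : MvPolynomial σ ℝ, Fintype.card σ • a = C (Fintype.card σ : ℝ) * a := by
    intro a; simp [nsmul_eq_mul]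
  rw [hn]
  rcases m with _ | m <;> rcases j with _ | _ | j <;> simp [h2, h4] <;> ring

lemma fischerForm_linForm_pow (z y : σ → ℝ) (m j : ℕ) :
    fischerForm σ (linForm z ^ (m + 2 * j)) (linForm y ^ m * normSqPoly σ ^ j) =
      (m + 2 * j).factorial * ((∑ i, z i * y i) ^ m * (∑ i, z i * z i) ^ j) := by
  induction j with
  | zero =>
    induction m with
    | zero =>
      have h := fischerForm_monomial (σ := σ) 0 1 1
      rw [show monomial 0 (1 : ℝ) = (1 : MvPolynomial σ ℝ) from rfl] at h
      simp [h]
    | succ m ih =>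
      have h : ∑ i, C (y i) * pderiv i (linForm z ^ (m + 1)) =
          ((m + 1 : ℝ) * ∑ i, z i * y i) • linForm z ^ m := by
        rw [smul_eq_C_mul, C_mul, map_sum, Finset.mul_sum, Finset.sum_mul]
        refine Finset.sum_congr rfl fun i _ => ?_
        rw [Derivation.leibniz_pow, pderiv_linForm]
        simp
        ring
      simp only [mul_zero, add_zero, pow_zero, mul_one] at ih ⊢
      rw [fischerForm_comm] at ih ⊢
      rw [pow_succ', fischerForm_linForm_mul, h, map_smul, ih, Nat.factorial_succ]
      push_cast [smul_eq_mul]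
      ring
  | succ j ih =>
    have h := laplacian_linForm_pow_mul z (m + 2 * j + 2) 0
    simp only [pow_zero, mul_one, Nat.cast_zero, mul_zero, zero_mul, map_zero, add_zero,
      Nat.add_sub_cancel] at h
    rw [fischerForm_comm] at ih ⊢
    rw [pow_succ', mul_left_comm, fischerForm_normSqPoly_mul,
      show m + 2 * (j + 1) = m + 2 * j + 2 by ring, h, C_mul', map_smul, ih, Nat.factorial_succ,
      Nat.factorial_succ]
    push_cast [smul_eq_mul]
    ring

end

/-- The coefficient of `t ^ (k - 2 * j)` in the monic Gegenbauer polynomial of degree `k` in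
dimension `n`. -/
noncomputable def gegenbauerCoeff (n k : ℕ) : ℕ → ℝ
  | 0 => 1
  | j + 1 => -(gegenbauerCoeff n k j * ((k - 2 * j) * (k - 2 * j - 1))) /
      (2 * (j + 1) * (2 * k - 2 * j - 4 + n))

lemma gegenbauerCoeff_succ {n k j : ℕ} (hn : 2 ≤ n) (hj : 2 * j + 2 ≤ k) :
    gegenbauerCoeff n k (j + 1) * (2 * (j + 1) * (2 * k - 2 * j - 4 + n)) =
      -(gegenbauerCoeff n k j * ((k - 2 * j) * (k - 2 * j - 1))) := by
  have hn' : (2 : ℝ) ≤ n := by exact_mod_cast hn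
  have hj' : (2 * j + 2 : ℝ) ≤ k := by exact_mod_cast hj
  have : (0 : ℝ) < 2 * (j + 1) * (2 * k - 2 * j - 4 + n) := by
    have : (0 : ℝ) ≤ j := j.cast_nonneg
    apply mul_pos <;> linarith
  rw [gegenbauerCoeff, div_mul_cancel₀ _ this.ne']

lemma sum_add_eq_zero_of_telescope {M : Type*} [AddCommGroup M] (A B : ℕ → M) (J : ℕ)
    (h0 : B 0 = 0) (hJ : A J = 0) (h : ∀ j < J, A j + B (j + 1) = 0) :
    ∑ j ∈ Finset.range (J + 1), (A j + B j) = 0 := by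
  rw [Finset.sum_add_distrib, Finset.sum_range_succ, Finset.sum_range_succ' B, h0, hJ, add_zero,
    add_zero, ← Finset.sum_add_distrib]
  exact Finset.sum_eq_zero fun j hj => h j (Finset.mem_range.1 hj)

lemma cast_sub_two_mul {k j : ℕ} (h : j ≤ k / 2) : ((k - 2 * j : ℕ) : ℝ) = k - 2 * j := by
  rw [Nat.cast_sub (by omega)]
  push_cast
  ring

lemma cast_sub_two_mul_half (k : ℕ) :
    (((k - 2 * (k / 2) : ℕ) : ℝ)) * ((k - 2 * (k / 2) : ℕ) - 1) = 0 := by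
  have : k - 2 * (k / 2) = 0 ∨ k - 2 * (k / 2) = 1 := by omega
  rcases this with h | h <;> simp [h]

section
open MvPolynomial
variable {σ : Type*} [Fintype σ]

/-- The zonal harmonic polynomial of degree `k` with pole `y`, for a unit vector `y`. -/
noncomputable def zonal (k : ℕ) (y : σ → ℝ) : MvPolynomial σ ℝ :=
  ∑ j ∈ Finset.range (k / 2 + 1),
    C (gegenbauerCoeff (Fintype.card σ) k j) * (linForm y ^ (k - 2 * j) * normSqPoly σ ^ j)

lemma laplacian_zonal (hσ : 2 ≤ Fintype.card σ) (k : ℕ) (y : σ → ℝ) (hy : ∑ i, y i * y i = 1) :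
    laplacian (zonal k y) = 0 := by
  simp only [zonal, map_sum, C_mul', map_smul, laplacian_linForm_pow_mul, hy, mul_one, smul_add,
    smul_smul]
  refine sum_add_eq_zero_of_telescope _ _ _ ?_ ?_ ?_
  · simp
  · rw [cast_sub_two_mul_half]
    simp
  · intro j hj
    have hrec := gegenbauerCoeff_succ (k := k) (j := j) hσ (by omega)
    rw [cast_sub_two_mul hj.le, cast_sub_two_mul (Nat.succ_le_of_lt hj),
      show k - 2 * (j + 1) = k - 2 * j - 2 by omega, Nat.add_sub_cancel, ← add_smul]
    convert zero_smul ℝ _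
    push_cast
    linear_combination hrec

end

/-- The monic Gegenbauer polynomial of degree `k` in dimension `n`. -/
noncomputable def gegenbauerPoly (n k : ℕ) : Polynomial ℝ :=
  ∑ j ∈ Finset.range (k / 2 + 1),
    Polynomial.C (gegenbauerCoeff n k j) * Polynomial.X ^ (k - 2 * j)

section
open MvPolynomial
variable {σ : Type*} [Fintype σ]

lemma fischerForm_zonal (hσ : 2 ≤ Fintype.card σ) (k : ℕ) (y z : σ → ℝ)
    (hy : ∑ i, y i * y i = 1) (hz : ∑ i, z i * z i = 1) :
    fischerForm σ (zonal k z) (zonal k y) =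
      k.factorial * (gegenbauerPoly (Fintype.card σ) k).eval (∑ i, z i * y i) := by
  have h1 : fischerForm σ (zonal k z) (zonal k y) = fischerForm σ (linForm z ^ k) (zonal k y) := by
    conv_lhs => rw [zonal, Finset.sum_range_succ']
    rw [map_add, LinearMap.add_apply, map_sum, LinearMap.sum_apply, Finset.sum_eq_zero]
    · simp [gegenbauerCoeff]
    · intro j _
      rw [pow_succ', mul_left_comm (linForm z ^ _), mul_left_comm, fischerForm_normSqPoly_mul,
        laplacian_zonal hσ k y hy, map_zero]
  rw [h1, zonal, gegenbauerPoly, map_sum, Polynomial.eval_finsetSum, Finset.mul_sum]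
  refine Finset.sum_congr rfl fun j hj => ?_
  have hj' : k - 2 * j + 2 * j = k := by have := Finset.mem_range.1 hj; omega
  have := fischerForm_linForm_pow z y (k - 2 * j) j
  rw [hj', hz] at this
  rw [C_mul', map_smul, this]
  simp
  ring

/-- Schoenberg's theorem: the Gegenbauer kernels are positive semidefinite on the sphere. -/
lemma gegenbauerPoly_posSemidef (hσ : 2 ≤ Fintype.card σ) (k : ℕ) {ι : Type*} [Fintype ι]
    (x : ι → σ → ℝ) (hx : ∀ a, ∑ i, x a i * x a i = 1) (c : ι → ℝ) :
    0 ≤ ∑ a, ∑ b, c a * c b *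
      (gegenbauerPoly (Fintype.card σ) k).eval (∑ i, x a i * x b i) := by
  have h := fischerForm_self_nonneg (∑ a, c a • zonal k (x a))
  simp only [map_sum, LinearMap.sum_apply, map_smul, LinearMap.smul_apply, smul_eq_mul,
    fischerForm_zonal hσ k _ _ (hx _) (hx _)] at h
  have hk : (0 : ℝ) < k.factorial := by positivity
  refine nonneg_of_mul_nonneg_right (h.trans_eq ?_) hk
  rw [Finset.mul_sum]
  refine Finset.sum_congr rfl fun a _ => ?_
  rw [Finset.mul_sum, Finset.mul_sum]
  exact Finset.sum_congr rfl fun b _ => by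
    simp only [mul_comm (x b _)]
    ring

end

section
open Polynomial

lemma gegenbauerPoly_ode {n : ℕ} (hn : 2 ≤ n) (k : ℕ) :
    (1 - X ^ 2) * derivative (derivative (gegenbauerPoly n k))
      - C ((n : ℝ) - 1) * X * derivative (gegenbauerPoly n k)
      + C ((k : ℝ) * (k + n - 2)) * gegenbauerPoly n k = 0 := by
  have key : ∀ j ∈ Finset.range (k / 2 + 1),
      (1 - X ^ 2) * derivative (derivative (C (gegenbauerCoeff n k j) * X ^ (k - 2 * j)))
      - C ((n : ℝ) - 1) * X * derivative (C (gegenbauerCoeff n k j) * X ^ (k - 2 * j))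
      + C ((k : ℝ) * (k + n - 2)) * (C (gegenbauerCoeff n k j) * X ^ (k - 2 * j)) =
      C (gegenbauerCoeff n k j * ((k - 2 * j : ℕ) * ((k - 2 * j : ℕ) - 1))) *
        X ^ (k - 2 * j - 2) +
      C (gegenbauerCoeff n k j * (2 * j * (2 * k - 2 * j + n - 2))) * X ^ (k - 2 * j) := by
    intro j hj
    have hm := cast_sub_two_mul (Nat.le_of_lt_succ (Finset.mem_range.1 hj))
    have hk : (k : ℝ) = (k - 2 * j : ℕ) + 2 * j := by rw [hm]; ring
    generalize k - 2 * j = m at hk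
    rw [hk]
    have h2 : (C 2 : ℝ[X]) = 2 := map_ofNat C 2
    rcases m with _ | _ | m <;> simp [h2] <;> ring
  rw [gegenbauerPoly]
  simp only [derivative_sum, Finset.mul_sum]
  rw [← Finset.sum_sub_distrib, ← Finset.sum_add_distrib, Finset.sum_congr rfl key]
  refine sum_add_eq_zero_of_telescope _ _ _ ?_ ?_ ?_
  · simp
  · rw [cast_sub_two_mul_half]
    simp
  · intro j hj
    have hrec := gegenbauerCoeff_succ (k := k) (j := j) hn (by omega)
    rw [cast_sub_two_mul hj.le, show k - 2 * (j + 1) = k - 2 * j - 2 by omega, ← add_mul, ← C_add]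
    convert zero_mul _
    rw [C_eq_zero]
    push_cast
    linear_combination hrec

lemma coeff_gegenbauerPoly_self (n k : ℕ) : (gegenbauerPoly n k).coeff k = 1 := by
  rw [gegenbauerPoly, finsetSum_coeff, Finset.sum_eq_single 0]
  · simp [gegenbauerCoeff]
  · intro j hj h0
    have := Finset.mem_range.1 hj
    rw [coeff_C_mul_X_pow, if_neg (by omega)]
  · simp

lemma gegenbauerPoly_ne_zero (n k : ℕ) : gegenbauerPoly n k ≠ 0 := fun h => by
  simpa [h] using coeff_gegenbauerPoly_self n k

lemma natDegree_gegenbauerPoly (n k : ℕ) : (gegenbauerPoly n k).natDegree = k := by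
  refine le_antisymm ?_ (le_natDegree_of_ne_zero (by simp [coeff_gegenbauerPoly_self]))
  refine natDegree_sum_le_of_forall_le _ _ fun j _ => ?_
  exact (natDegree_C_mul_X_pow_le _ _).trans (Nat.sub_le _ _)

end

section
open Polynomial MeasureTheory Set

lemma intervalIntegrable_one_sub_sq_rpow {n : ℕ} (hn : 2 ≤ n) :
    IntervalIntegrable (fun t : ℝ => (1 - t ^ 2) ^ (((n : ℝ) - 3) / 2)) volume (-1) 1 := by
  rcases hn.eq_or_lt with rfl | hn
  · refine intervalIntegral.intervalIntegrable_deriv_of_nonneg (g := Real.arcsin)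
      Real.continuous_arcsin.continuousOn (fun t ht => ?_) (fun t ht => ?_) <;>
    rw [min_eq_left (by norm_num), max_eq_right (by norm_num)] at ht
    · have h := Real.hasDerivAt_arcsin ht.1.ne' ht.2.ne
      rwa [Real.sqrt_eq_rpow, one_div, ← Real.rpow_neg (by nlinarith [ht.1, ht.2]),
        show (-(1 / 2) : ℝ) = ((2 : ℕ) - 3) / 2 by norm_num] at h
    · exact Real.rpow_nonneg (by nlinarith [ht.1, ht.2]) _
  · refine Continuous.intervalIntegrable (Continuous.rpow_const (by fun_prop) fun t => Or.inr ?_) _ _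
    have : (3 : ℝ) ≤ n := by exact_mod_cast hn
    linarith

/-- Integration of a polynomial against the Gegenbauer weight of dimension `n`. -/
noncomputable def gegenbauerIntegral (n : ℕ) (p : ℝ[X]) : ℝ :=
  ∫ t in (-1 : ℝ)..1, p.eval t * (1 - t ^ 2) ^ (((n : ℝ) - 3) / 2)

lemma intervalIntegrable_eval_mul_weight {n : ℕ} (hn : 2 ≤ n) (p : ℝ[X]) :
    IntervalIntegrable (fun t : ℝ => p.eval t * (1 - t ^ 2) ^ (((n : ℝ) - 3) / 2))
      volume (-1) 1 :=
  (intervalIntegrable_one_sub_sq_rpow hn).continuousOn_mul p.continuous.continuousOn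

lemma gegenbauerIntegral_add {n : ℕ} (hn : 2 ≤ n) (p q : ℝ[X]) :
    gegenbauerIntegral n (p + q) = gegenbauerIntegral n p + gegenbauerIntegral n q := by
  rw [gegenbauerIntegral, gegenbauerIntegral, gegenbauerIntegral,
    ← intervalIntegral.integral_add (intervalIntegrable_eval_mul_weight hn p)
      (intervalIntegrable_eval_mul_weight hn q)]
  simp only [eval_add, add_mul]

lemma gegenbauerIntegral_C_mul (n : ℕ) (c : ℝ) (p : ℝ[X]) :
    gegenbauerIntegral n (C c * p) = c * gegenbauerIntegral n p := by
  rw [gegenbauerIntegral, gegenbauerIntegral, ← intervalIntegral.integral_const_mul]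
  simp only [eval_mul, eval_C, mul_assoc]

lemma eq_zero_of_gegenbauerIntegral_mul_self {n : ℕ} (hn : 2 ≤ n) {p : ℝ[X]}
    (hp : gegenbauerIntegral n (p * p) = 0) : p = 0 := by
  by_contra h0
  have hnonneg : ∀ t ∈ Ioc (-1 : ℝ) 1,
      0 ≤ (p * p).eval t * (1 - t ^ 2) ^ (((n : ℝ) - 3) / 2) := fun t ht => by
    rw [eval_mul]
    exact mul_nonneg (mul_self_nonneg _) (Real.rpow_nonneg (by nlinarith [ht.1, ht.2]) _)
  refine hp.not_gt ?_
  rw [gegenbauerIntegral, intervalIntegral.integral_pos_iff_support_of_nonneg_ae' ?_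
    (intervalIntegrable_eval_mul_weight hn _)]
  · refine ⟨by norm_num, ?_⟩
    have hsub : Ioo (-1 : ℝ) 1 \ (p.rootSet ℝ) ⊆ Function.support
        (fun t => (p * p).eval t * (1 - t ^ 2) ^ (((n : ℝ) - 3) / 2)) ∩ Ioc (-1) 1 := by
      rintro t ⟨ht, hr⟩
      refine ⟨?_, Ioo_subset_Ioc_self ht⟩
      have hpt : p.eval t ≠ 0 := fun h => hr (by simp [mem_rootSet, h0, h])
      have hw : 0 < (1 - t ^ 2) ^ (((n : ℝ) - 3) / 2) :=
        Real.rpow_pos_of_pos (by nlinarith [ht.1, ht.2]) _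
      rw [Function.mem_support, eval_mul]
      exact mul_ne_zero (mul_ne_zero hpt hpt) hw.ne'
    refine lt_of_lt_of_le ?_ (measure_mono hsub)
    rw [measure_sdiff_null ((p.rootSet_finite ℝ).measure_zero _)]
    simp
  · rw [uIoc_of_le (by norm_num)]
    exact (ae_restrict_iff' measurableSet_Ioc).2 (Filter.Eventually.of_forall hnonneg)

lemma gegenbauerIntegral_weighted_derivative {n : ℕ} (hn : 2 ≤ n) (v : ℝ[X]) :
    gegenbauerIntegral n ((1 - X ^ 2) * derivative v - C ((n : ℝ) - 1) * X * v) = 0 := by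
  have hn' : (2 : ℝ) ≤ n := by exact_mod_cast hn
  have hr : 0 < ((n : ℝ) - 1) / 2 := by linarith
  rw [gegenbauerIntegral, intervalIntegral.integral_eq_sub_of_hasDerivAt_of_le (by norm_num)
    (f := fun t => (1 - t ^ 2) ^ (((n : ℝ) - 1) / 2) * v.eval t) ?_ ?_
    (intervalIntegrable_eval_mul_weight hn _)]
  · norm_num [Real.zero_rpow hr.ne']
  · exact ((Continuous.rpow_const (by fun_prop) fun t => Or.inr hr.le).mul
      v.continuous).continuousOn
  · intro t ht
    have hpos : 0 < 1 - t ^ 2 := by nlinarith [ht.1, ht.2]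
    have h1 : HasDerivAt (fun t : ℝ => 1 - t ^ 2) (-(2 * t)) t := by
      simpa using (hasDerivAt_pow 2 t).const_sub 1
    have h2 := (h1.rpow_const (p := ((n : ℝ) - 1) / 2) (Or.inl hpos.ne')).mul (v.hasDerivAt t)
    have e1 : ((n : ℝ) - 1) / 2 - 1 = ((n : ℝ) - 3) / 2 := by ring
    have e2 : (1 - t ^ 2) ^ (((n : ℝ) - 1) / 2) =
        (1 - t ^ 2) ^ (((n : ℝ) - 3) / 2) * (1 - t ^ 2) := by
      rw [← Real.rpow_add_one hpos.ne']
      congr 1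
      ring
    rw [e1, e2] at h2
    refine h2.congr_deriv ?_
    simp only [eval_sub, eval_mul, eval_one, eval_pow, eval_X, eval_C]
    ring

lemma gegenbauerIntegral_gegenbauerPoly_mul {n : ℕ} (hn : 2 ≤ n) {k l : ℕ} (hkl : k ≠ l) :
    gegenbauerIntegral n (gegenbauerPoly n k * gegenbauerPoly n l) = 0 := by
  have hk := gegenbauerPoly_ode hn k
  have hl := gegenbauerPoly_ode hn l
  set p := gegenbauerPoly n k
  set q := gegenbauerPoly n l
  have h := gegenbauerIntegral_weighted_derivative hn (derivative p * q - p * derivative q)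
  have e : (1 - X ^ 2) * derivative (derivative p * q - p * derivative q)
      - C ((n : ℝ) - 1) * X * (derivative p * q - p * derivative q) =
      C ((l : ℝ) * (l + n - 2) - k * (k + n - 2)) * (p * q) := by
    rw [C_sub (a := (l : ℝ) * (l + n - 2))]
    simp only [derivative_sub, derivative_mul]
    linear_combination q * hk - p * hl
  rw [e, gegenbauerIntegral_C_mul] at h
  refine (mul_eq_zero.1 h).resolve_left fun h0 => ?_
  have hn' : (2 : ℝ) ≤ n := by exact_mod_cast hn
  have hfac : ((l : ℝ) - k) * (l + k + (n - 2)) = 0 := by linear_combination h0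
  rcases mul_eq_zero.1 hfac with h1 | h1
  · exact hkl (by exact_mod_cast (sub_eq_zero.1 h1).symm)
  · have hk0 : (0 : ℝ) ≤ k := k.cast_nonneg
    have hl0 : (0 : ℝ) ≤ l := l.cast_nonneg
    refine hkl ?_
    have hk1 : (k : ℝ) = 0 := by linarith
    have hl1 : (l : ℝ) = 0 := by linarith
    exact_mod_cast hk1.trans hl1.symm

lemma natDegree_sub_lt_or_eq_zero {p q : ℝ[X]} (hq : q ≠ 0) (hpq : p.natDegree = q.natDegree) :
    p - C (p.leadingCoeff / q.leadingCoeff) * q = 0 ∨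
    (p - C (p.leadingCoeff / q.leadingCoeff) * q).natDegree < p.natDegree := by
  have hlq := leadingCoeff_ne_zero.2 hq
  have hle : (p - C (p.leadingCoeff / q.leadingCoeff) * q).natDegree ≤ p.natDegree :=
    (natDegree_sub_le_of_le le_rfl ((natDegree_C_mul_le _ _).trans hpq.ge)).trans_eq (max_self _)
  refine hle.lt_or_eq.symm.imp_left fun h => ?_
  rw [← leadingCoeff_eq_zero, leadingCoeff, h, coeff_sub, coeff_C_mul, coeff_natDegree, hpq,
    coeff_natDegree, div_mul_cancel₀ _ hlq, sub_self]

lemma gegenbauerIntegral_mul_eq_zero_of_natDegree_lt {n : ℕ} (hn : 2 ≤ n) {R : ℕ → ℝ[X]}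
    (hdeg : ∀ k, (R k).natDegree = k) (hne : ∀ k, R k ≠ 0)
    (horth : ∀ k l, k ≠ l → gegenbauerIntegral n (R k * R l) = 0) (k : ℕ) :
    ∀ q : ℝ[X], q.natDegree < k → gegenbauerIntegral n (R k * q) = 0 := by
  intro q
  induction hd : q.natDegree using Nat.strong_induction_on generalizing q with
  | _ d ih =>
    intro hdk
    set c := q.leadingCoeff / (R d).leadingCoeff
    have hsplit : R k * q = R k * (q - C c * R d) + C c * (R k * R d) := by ring
    rw [hsplit, gegenbauerIntegral_add hn, gegenbauerIntegral_C_mul, horth k d hdk.ne',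
      mul_zero, add_zero]
    rcases natDegree_sub_lt_or_eq_zero (p := q) (hne d) (hd.trans (hdeg d).symm) with h | h
    · rw [h]
      simp [gegenbauerIntegral]
    · rw [hd] at h
      exact ih _ h _ rfl (h.trans hdk)

/-- A family of nonzero orthogonal polynomials of degrees `0, 1, 2, …` for the Gegenbauer weight
consists of multiples of the Gegenbauer polynomials. -/
lemma exists_eq_C_mul_gegenbauerPoly {n : ℕ} (hn : 2 ≤ n) {R : ℕ → ℝ[X]}
    (hdeg : ∀ k, (R k).natDegree = k) (hne : ∀ k, R k ≠ 0)
    (horth : ∀ k l, k ≠ l → gegenbauerIntegral n (R k * R l) = 0) (k : ℕ) :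
    ∃ c : ℝ, R k = C c * gegenbauerPoly n k := by
  have hQ := gegenbauerIntegral_mul_eq_zero_of_natDegree_lt hn (natDegree_gegenbauerPoly n)
    (gegenbauerPoly_ne_zero n) (fun k l => gegenbauerIntegral_gegenbauerPoly_mul hn) k
  have hR := gegenbauerIntegral_mul_eq_zero_of_natDegree_lt hn hdeg hne horth k
  have hlt := natDegree_sub_lt_or_eq_zero (p := R k) (gegenbauerPoly_ne_zero n k)
    ((hdeg k).trans (natDegree_gegenbauerPoly n k).symm)
  set c := (R k).leadingCoeff / (gegenbauerPoly n k).leadingCoeff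
  refine ⟨c, sub_eq_zero.1 (hlt.elim id fun hlt => ?_)⟩
  rw [hdeg] at hlt
  apply eq_zero_of_gegenbauerIntegral_mul_self hn
  have hsplit : (R k - C c * gegenbauerPoly n k) * (R k - C c * gegenbauerPoly n k) =
      R k * (R k - C c * gegenbauerPoly n k) +
        C (-c) * (gegenbauerPoly n k * (R k - C c * gegenbauerPoly n k)) := by
    rw [C_neg]
    ring
  rw [hsplit, gegenbauerIntegral_add hn, gegenbauerIntegral_C_mul, hQ _ hlt, hR _ hlt]
  simp

end

open scoped RealInnerProductSpace

/-- The Delsarte–Goethals–Seidel linear programming bound for the kissing number.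
The family `P k` is the Gegenbauer/ultraspherical family for dimension `n`,
characterized by: `P k` is a polynomial of degree `k`, the family is orthogonal on
`[-1,1]` with respect to the weight `(1-t²)^((n-3)/2)`, and `P k 1 = 1`. -/
theorem stmt11 (n : ℕ) (hn : 2 ≤ n) (P : ℕ → ℝ → ℝ)
    (hdeg : ∀ k, ∃ p : Polynomial ℝ, p.natDegree = k ∧ ∀ t, P k t = p.eval t)
    (horth : ∀ k l, k ≠ l →
      ∫ t in (-1 : ℝ)..1, P k t * P l t * (1 - t ^ 2) ^ (((n : ℝ) - 3) / 2) = 0)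
    (hnorm : ∀ k, P k 1 = 1)
    (f : ℕ → ℝ) (hf : ∀ k, 0 ≤ f k) (hsum : Summable f)
    (hg : ∀ t ∈ Set.Icc (-1 : ℝ) (1 / 2), (∑' k, f k * P k t) ≤ -1)
    (N : ℕ) (x : Fin N → EuclideanSpace ℝ (Fin n))
    (hx : ∀ i, ‖x i‖ = 1)
    (hangle : ∀ i j, i ≠ j → ⟪x i, x j⟫ ≤ (1 / 2 : ℝ)) :
    (N : ℝ) ≤ 1 + ∑' k, f k := by
  choose R hRdeg hR using hdeg
  have hRne : ∀ k, R k ≠ 0 := fun k h => by simpa [hR, h] using hnorm k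
  have hRorth : ∀ k l, k ≠ l → gegenbauerIntegral n (R k * R l) = 0 := fun k l hkl => by
    simpa [gegenbauerIntegral, hR] using horth k l hkl
  have hinner : ∀ u v : EuclideanSpace ℝ (Fin n), ⟪u, v⟫ = ∑ i, u i * v i := fun u v => by
    simp [PiLp.inner_apply, mul_comm]
  have hpsd : ∀ k, ∀ (M : ℕ) (u : Fin M → EuclideanSpace ℝ (Fin n)), (∀ a, ‖u a‖ = 1) →
      ∀ c : Fin M → ℝ, 0 ≤ ∑ a, ∑ b, c a * c b * P k ⟪u a, u b⟫ := by
    intro k M u hu c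
    obtain ⟨d, hd⟩ := exists_eq_C_mul_gegenbauerPoly hn hRdeg hRne hRorth k
    have hQ : ∀ (M : ℕ) (u : Fin M → EuclideanSpace ℝ (Fin n)), (∀ a, ‖u a‖ = 1) →
        ∀ c : Fin M → ℝ, 0 ≤ ∑ a, ∑ b, c a * c b * (gegenbauerPoly n k).eval ⟪u a, u b⟫ := by
      intro M u hu c
      have h := gegenbauerPoly_posSemidef (σ := Fin n) (by simpa using hn) k
        (fun a i => u a i) (fun a => by rw [← hinner, real_inner_self_eq_norm_sq, hu, one_pow]) c
      simpa only [Fintype.card_fin, ← hinner] using h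
    have hd1 : d * (gegenbauerPoly n k).eval 1 = 1 := by
      have h := hnorm k
      rwa [hR, hd, Polynomial.eval_mul, Polynomial.eval_C] at h
    have hd0 : 0 ≤ d := by
      have h1 := hQ 1 (fun _ => EuclideanSpace.single ⟨0, by omega⟩ 1) (by simp) (fun _ => 1)
      simp only [Finset.univ_unique, Finset.sum_singleton, real_inner_self_eq_norm_sq] at h1
      norm_num at h1
      by_contra! hneg
      nlinarith
    have := mul_nonneg hd0 (hQ M u hu c)
    simp only [Finset.mul_sum] at this
    refine this.trans_eq (Finset.sum_congr rfl fun a _ => Finset.sum_congr rfl fun b _ => ?_)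
    rw [hR, hd, Polynomial.eval_mul, Polynomial.eval_C]
    ring
  have hself : ∀ i, ⟪x i, x i⟫ = (1 : ℝ) := fun i => by
    rw [real_inner_self_eq_norm_sq, hx, one_pow]
  have habs : ∀ k i j, |P k ⟪x i, x j⟫| ≤ 1 := by
    intro k i j
    have hu : ∀ a : Fin 2, ‖(![x i, x j] : Fin 2 → _) a‖ = 1 := by
      intro a
      fin_cases a <;> simp [hx]
    have h1 := hpsd k 2 ![x i, x j] hu ![1, 1]
    have h2 := hpsd k 2 ![x i, x j] hu ![1, -1]
    simp only [Fin.sum_univ_two, Matrix.cons_val_zero, Matrix.cons_val_one, hself, hnorm,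
      real_inner_comm (x i) (x j)] at h1 h2
    rw [abs_le]
    constructor <;> linarith
  have hs : ∀ i j, Summable fun k => f k * P k ⟪x i, x j⟫ := fun i j =>
    hsum.of_norm_bounded fun k => by
      rw [Real.norm_eq_abs, abs_mul, abs_of_nonneg (hf k)]
      exact mul_le_of_le_one_right (hf k) (habs k i j)
  have htotal : 0 ≤ ∑ i, ∑ j, ∑' k, f k * P k ⟪x i, x j⟫ := by
    have hswap : ∑ i, ∑ j, ∑' k, f k * P k ⟪x i, x j⟫ =
        ∑' k, ∑ i, ∑ j, f k * P k ⟪x i, x j⟫ := by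
      rw [Summable.tsum_finsetSum fun i _ => summable_sum fun j _ => hs i j]
      exact Finset.sum_congr rfl fun i _ => (Summable.tsum_finsetSum fun j _ => hs i j).symm
    rw [hswap]
    refine tsum_nonneg fun k => ?_
    have h := mul_nonneg (hf k) (hpsd k N x hx fun _ => 1)
    simpa only [one_mul, Finset.mul_sum] using h
  have hbound : ∀ i j, ∑' k, f k * P k ⟪x i, x j⟫ ≤ (if i = j then 1 + ∑' k, f k else 0) - 1 := by
    intro i j
    split_ifs with hij
    · subst hij
      simp only [hself, hnorm, mul_one]
      simp
    · rw [zero_sub]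
      refine hg _ ⟨?_, hangle i j hij⟩
      have := abs_le.1 (abs_real_inner_le_norm (x i) (x j))
      rw [hx, hx, one_mul] at this
      exact this.1
  have hfinal := htotal.trans
    (Finset.sum_le_sum fun i _ => Finset.sum_le_sum fun j _ => hbound i j)
  simp only [Finset.sum_sub_distrib, Finset.sum_ite_eq, Finset.mem_univ, if_true, Finset.sum_const,
    Finset.card_univ, Fintype.card_fin, nsmul_eq_mul, mul_one] at hfinal
  rcases N.eq_zero_or_pos with rfl | hN
  · have : 0 ≤ ∑' k, f k := tsum_nonneg hf
    push_cast
    linarith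
  · have hN' : (0 : ℝ) < N := by exact_mod_cast hN
    have : 0 ≤ (N : ℝ) * (1 + ∑' k, f k - N) := by linarith
    linarith [nonneg_of_mul_nonneg_right this hN']
end

section
/- Witsenhausen's bound: if A ⊆ S^{n-1} is a measurable set containing no two orthogonal vectors, then the normalized surface measure of A is at most 1/n. -/
open scoped RealInnerProductSpace
open MeasureTheory Metric


/-- If a group with a left-invariant probability measure `ν` acts transitively on a space with an
invariant probability measure `μ`, then `μ` is the image of `ν` under `g ↦ g⁻¹ • x`. -/
theorem measure_inv_smul_mem_eq {G X : Type*} [Group G] [MeasurableSpace G] [MeasurableSpace X]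
    [MeasurableMul G] [MulAction G X] [MulAction.IsPretransitive G X]
    (hsmul : Measurable fun p : G × X => p.1⁻¹ • p.2)
    (ν : Measure G) [IsProbabilityMeasure ν] [ν.IsMulLeftInvariant]
    (μ : Measure X) [IsProbabilityMeasure μ] (hμ : ∀ g : G, μ.map (g • ·) = μ)
    {A : Set X} (hA : MeasurableSet A) (x : X) :
    ν {g | g⁻¹ • x ∈ A} = μ A := by
  have hS : MeasurableSet {p : G × X | p.1⁻¹ • p.2 ∈ A} := hsmul hA
  have hconst : ∀ y : X, ν {g | g⁻¹ • y ∈ A} = ν {g | g⁻¹ • x ∈ A} := by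
    intro y
    obtain ⟨σ, rfl⟩ := MulAction.exists_smul_eq G x y
    rw [← measure_preimage_mul ν σ⁻¹ {g | g⁻¹ • x ∈ A}]
    congr 1
    ext g
    simp [mul_smul]
  have hfiber : ∀ g : G, μ {y | g⁻¹ • y ∈ A} = μ A := by
    intro g
    have hg : Measurable fun y : X => g⁻¹ • y := hsmul.comp measurable_prodMk_left
    conv_rhs => rw [← hμ g⁻¹, Measure.map_apply hg hA]
    rfl
  have h1 := Measure.prod_apply (μ := ν) (ν := μ) hS
  have h2 := Measure.prod_apply_symm (μ := ν) (ν := μ) hS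
  simp only [Set.preimage_ofPred_eq, hfiber, hconst, lintegral_const, measure_univ, mul_one]
    at h1 h2
  exact h2.symm.trans h1

section UnitaryGroup

variable {E : Type*} [NormedAddCommGroup E] [InnerProductSpace ℝ E]

theorem continuousStar_clm [CompleteSpace E] : ContinuousStar (E →L[ℝ] E) :=
  ⟨(ContinuousLinearMap.adjoint (𝕜 := ℝ) (E := E) (F := E)).continuous⟩

theorem isTopologicalGroup_unitary_clm [CompleteSpace E] :
    IsTopologicalGroup (unitary (E →L[ℝ] E)) := by
  have := continuousStar_clm (E := E)
  infer_instance

theorem compactSpace_unitary_clm [FiniteDimensional ℝ E] [CompleteSpace E] :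
    CompactSpace (unitary (E →L[ℝ] E)) := by
  have := continuousStar_clm (E := E)
  have : ProperSpace (E →L[ℝ] E) := FiniteDimensional.proper_real _
  refine isCompact_iff_compactSpace.mp (isCompact_of_isClosed_isBounded isClosed_unitary ?_)
  refine isBounded_iff_forall_norm_le.mpr ⟨1, fun u hu => ?_⟩
  refine u.opNorm_le_bound zero_le_one fun x => ?_
  rw [one_mul]
  exact (Unitary.norm_map ⟨u, hu⟩ x).le

/-- The action of the orthogonal group on the unit sphere. -/
noncomputable abbrev unitarySphereAction [CompleteSpace E] :
    MulAction (unitary (E →L[ℝ] E)) (sphere (0 : E) 1) where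
  smul u x := ⟨(u : E →L[ℝ] E) x, by
    rw [mem_sphere_zero_iff_norm, Unitary.norm_map, norm_eq_of_mem_sphere]⟩
  one_smul _ := rfl
  mul_smul _ _ _ := rfl

theorem isPretransitive_unitarySphereAction [CompleteSpace E] :
    letI := unitarySphereAction (E := E)
    MulAction.IsPretransitive (unitary (E →L[ℝ] E)) (sphere (0 : E) 1) := by
  let := unitarySphereAction (E := E)
  refine ⟨fun x y => ⟨Unitary.linearIsometryEquiv.symm (ℝ ∙ ((x : E) - y))ᗮ.reflection, ?_⟩⟩
  exact Subtype.ext (Submodule.reflection_sub (by simp))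

end UnitaryGroup

/-- Witsenhausen's bound: if `A` is a measurable subset of the unit sphere `S^{n-1}`
containing no two orthogonal vectors, then its normalized (rotation-invariant
probability) surface measure is at most `1/n`. -/
theorem stmt13 (n : ℕ)
    (μ : Measure (sphere (0 : EuclideanSpace ℝ (Fin n)) 1))
    (hprob : IsProbabilityMeasure μ)
    (hinv : ∀ T : EuclideanSpace ℝ (Fin n) ≃ₗᵢ[ℝ] EuclideanSpace ℝ (Fin n),
      μ.map (fun x : sphere (0 : EuclideanSpace ℝ (Fin n)) 1 => (⟨T x.1, by
        have hx := x.2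
        simp only [mem_sphere_iff_norm, sub_zero] at hx ⊢
        rw [T.norm_map]; exact hx⟩ : sphere (0 : EuclideanSpace ℝ (Fin n)) 1)) = μ)
    (A : Set (sphere (0 : EuclideanSpace ℝ (Fin n)) 1)) (hmeas : MeasurableSet A)
    (horth : ∀ x ∈ A, ∀ y ∈ A,
      ⟪(x : EuclideanSpace ℝ (Fin n)), (y : EuclideanSpace ℝ (Fin n))⟫ ≠ 0) :
    μ A ≤ 1 / n := by
  let E := EuclideanSpace ℝ (Fin n)
  let G := unitary (E →L[ℝ] E)
  have : IsTopologicalGroup G := isTopologicalGroup_unitary_clm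
  have : CompactSpace G := compactSpace_unitary_clm
  have : ProperSpace (E →L[ℝ] E) := FiniteDimensional.proper_real _
  let : MulAction G (sphere (0 : E) 1) := unitarySphereAction
  have : MulAction.IsPretransitive G (sphere (0 : E) 1) := isPretransitive_unitarySphereAction
  let ν : Measure G := Measure.haarMeasure ⊤
  have : IsProbabilityMeasure ν := ⟨Measure.haarMeasure_self (K₀ := ⊤)⟩
  have hsmul : Measurable fun p : G × sphere (0 : E) 1 => p.1⁻¹ • p.2 := by
    refine Continuous.measurable (Continuous.subtype_mk ?_ _)
    exact (continuous_subtype_val.comp continuous_fst.inv).clm_apply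
      (continuous_subtype_val.comp continuous_snd)
  let b := EuclideanSpace.basisFun (Fin n) ℝ
  let e : Fin n → sphere (0 : E) 1 := fun i => ⟨b i, mem_sphere_zero_iff_norm.mpr (b.orthonormal.1 i)⟩
  let S : Fin n → Set G := fun i => {g | g⁻¹ • e i ∈ A}
  have hS : ∀ i, ν (S i) = μ A := fun i =>
    measure_inv_smul_mem_eq hsmul ν μ (fun g => hinv (Unitary.linearIsometryEquiv g)) hmeas (e i)
  have hSmeas : ∀ i, MeasurableSet (S i) := fun i =>
    (hsmul.comp measurable_prodMk_right) hmeas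
  have hdisj : Pairwise (Function.onFun Disjoint S) := by
    intro i j hij
    refine Set.disjoint_left.mpr fun g hi hj => horth _ hi _ hj ?_
    exact (Unitary.inner_map_map g⁻¹ (b i) (b j)).trans (b.orthonormal.2 hij)
  have hsum : (n : ENNReal) * μ A ≤ 1 := by
    calc (n : ENNReal) * μ A = ∑ i, ν (S i) := by simp [hS]
      _ = ν (⋃ i, S i) := by rw [measure_iUnion hdisj hSmeas, tsum_fintype]
      _ ≤ 1 := prob_le_one
  rw [ENNReal.le_div_iff_mul_le (by simp) (by simp), mul_comm]
  exact hsum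
end

section
/- Let G = (V,E) be a finite graph. Then las_t(G) = α(G) for every t ≥ α(G); in particular the Lasserre hierarchy is exact at step t = α(G). -/
open scoped Classical
open Finset Matrix

def IsIndep {V : Type*} (G : SimpleGraph V) (I : Finset V) : Prop :=
  ∀ x ∈ I, ∀ y ∈ I, ¬ G.Adj x y

noncomputable def indepNum {V : Type*} [Fintype V] (G : SimpleGraph V) : ℕ :=
  Finset.univ.sup fun I : Finset V => if IsIndep G I then I.card else 0

/-- The set `I_t` of independent sets of cardinality at most `t`, as a type. -/
def Idx {V : Type*} (G : SimpleGraph V) (t : ℕ) : Type _ :=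
  {J : Finset V // IsIndep G J ∧ J.card ≤ t}

noncomputable instance {V : Type*} [Fintype V] (G : SimpleGraph V) (t : ℕ) :
    Fintype (Idx G t) := by unfold Idx; infer_instance

/-- The combinatorial moment matrix `M_t(y)`. -/
noncomputable def momentMatrix {V : Type*} [Fintype V] (G : SimpleGraph V) (t : ℕ)
    (y : Finset V → ℝ) : Matrix (Idx G t) (Idx G t) ℝ :=
  Matrix.of fun J J' =>
    if IsIndep G (J.1 ∪ J'.1) ∧ (J.1 ∪ J'.1).card ≤ 2 * t then y (J.1 ∪ J'.1) else 0

/-- The Lasserre bound of step `t`. -/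
noncomputable def lasserre {V : Type*} [Fintype V] (G : SimpleGraph V) (t : ℕ) : ℝ :=
  sSup {r : ℝ | ∃ y : Finset V → ℝ,
    (∀ S : Finset V, IsIndep G S → S.card ≤ 2 * t → 0 ≤ y S) ∧
    y ∅ = 1 ∧ (momentMatrix G t y).PosSemidef ∧ r = ∑ i : V, y {i}}

theorem IsIndep.mono {V : Type*} {G : SimpleGraph V} {I J : Finset V} (hI : IsIndep G I)
    (h : J ⊆ I) : IsIndep G J :=
  fun x hx y hy => hI x (h hx) y (h hy)

theorem IsIndep.card_le_indepNum {V : Type*} [Fintype V] {G : SimpleGraph V} {I : Finset V}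
    (hI : IsIndep G I) : I.card ≤ indepNum G := by
  have h := Finset.le_sup (f := fun I : Finset V => if IsIndep G I then I.card else 0)
    (Finset.mem_univ I)
  simpa [indepNum, hI] using h

theorem isIndep_empty {V : Type*} (G : SimpleGraph V) : IsIndep G ∅ := by
  simp [IsIndep]

theorem isIndep_singleton {V : Type*} (G : SimpleGraph V) (i : V) : IsIndep G {i} := by
  simp [IsIndep]

theorem exists_isIndep_card_eq_indepNum {V : Type*} [Fintype V] (G : SimpleGraph V) :
    ∃ I : Finset V, IsIndep G I ∧ I.card = indepNum G := by
  obtain ⟨I, -, hI⟩ := Finset.exists_mem_eq_sup (Finset.univ : Finset (Finset V))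
    Finset.univ_nonempty (fun I : Finset V => if IsIndep G I then I.card else 0)
  by_cases h : IsIndep G I
  · exact ⟨I, h, by simpa [indepNum, h] using hI.symm⟩
  · exact ⟨∅, isIndep_empty G, by simpa [indepNum, h] using hI.symm⟩

theorem sum_neg_one_pow_card_interval {V : Type*} [Fintype V] (K L : Finset V) :
    (∑ T : Finset V, if K ⊆ T ∧ T ⊆ L then (-1 : ℝ) ^ T.card else 0)
      = if K = L then (-1 : ℝ) ^ L.card else 0 := by
  by_cases hKL : K ⊆ L
  · have hI : Finset.univ.filter (fun T : Finset V => K ⊆ T ∧ T ⊆ L) = Finset.Icc K L := by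
      ext T; simp
    rw [← Finset.sum_filter, hI, Finset.Icc_eq_image_powerset hKL, Finset.sum_image]
    · have hcard : ∀ x ∈ (L \ K).powerset,
          (-1 : ℝ) ^ (K ∪ x).card = (-1) ^ K.card * (-1) ^ x.card := by
        intro x hx
        rw [Finset.card_union_of_disjoint, pow_add]
        exact Finset.disjoint_of_subset_right (Finset.mem_powerset.1 hx) Finset.disjoint_sdiff
      rw [Finset.sum_congr rfl hcard, ← Finset.mul_sum]
      split_ifs with h
      · simp [h]
      · have hne : (L \ K).Nonempty := by
          rw [Finset.sdiff_nonempty]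
          exact fun h' => h (hKL.antisymm h')
        have h0 := Finset.sum_powerset_neg_one_pow_card_of_nonempty hne
        have h1 : (∑ x ∈ (L \ K).powerset, (-1 : ℝ) ^ x.card) = 0 := by exact_mod_cast h0
        rw [h1, mul_zero]
    · intro x hx y hy hxy
      have hx' := Finset.mem_powerset.1 (Finset.mem_coe.1 hx)
      have hy' := Finset.mem_powerset.1 (Finset.mem_coe.1 hy)
      ext a
      have h1 := @hx' a
      have h2 := @hy' a
      have h3 := Finset.ext_iff.1 hxy a
      simp only [Finset.mem_sdiff, Finset.mem_union] at h1 h2 h3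
      tauto
  · rw [if_neg (fun h => hKL h.subset)]
    exact Finset.sum_eq_zero fun T _ => if_neg fun h => hKL (h.1.trans h.2)

/-- The Möbius transform of `z` over supersets. -/
noncomputable def upperMobius {V : Type*} [Fintype V] (z : Finset V → ℝ) (S : Finset V) : ℝ :=
  ∑ K : Finset V, if S ⊆ K then (-1) ^ (S.card + K.card) * z K else 0

theorem sum_upperMobius {V : Type*} [Fintype V] (z : Finset V → ℝ) (K : Finset V) :
    (∑ T : Finset V, if K ⊆ T then upperMobius z T else 0) = z K := by
  have h1 : ∀ T : Finset V, (if K ⊆ T then upperMobius z T else 0)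
      = ∑ L : Finset V, (if K ⊆ T ∧ T ⊆ L then (-1 : ℝ) ^ T.card else 0)
          * ((-1) ^ L.card * z L) := by
    intro T
    by_cases h : K ⊆ T
    · simp [h, upperMobius, pow_add, mul_assoc]
    · simp [h]
  simp_rw [h1]
  rw [Finset.sum_comm]
  simp_rw [← Finset.sum_mul, sum_neg_one_pow_card_interval, ite_mul, zero_mul]
  rw [Finset.sum_ite_eq, if_pos (Finset.mem_univ K), ← mul_assoc, ← mul_pow]
  simp

theorem upperMobius_eq_zero {V : Type*} [Fintype V] {G : SimpleGraph V} {z : Finset V → ℝ}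
    (hz : ∀ K, ¬ IsIndep G K → z K = 0) {S : Finset V} (hS : ¬ IsIndep G S) :
    upperMobius z S = 0 := by
  refine Finset.sum_eq_zero fun K _ => ?_
  split_ifs with h
  · rw [hz K fun hK => hS (hK.mono h), mul_zero]
  · rfl

theorem momentMatrix_apply {V : Type*} [Fintype V] {G : SimpleGraph V} {t : ℕ}
    (ht : indepNum G ≤ t) (y : Finset V → ℝ) (J J' : Idx G t) :
    momentMatrix G t y J J' = if IsIndep G (J.1 ∪ J'.1) then y (J.1 ∪ J'.1) else 0 := by
  have h : IsIndep G (J.1 ∪ J'.1) → (J.1 ∪ J'.1).card ≤ 2 * t := fun h => by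
    have := h.card_le_indepNum
    omega
  simp only [momentMatrix, Matrix.of_apply, and_iff_left_of_imp h]

theorem sum_idx_subset {V : Type*} [Fintype V] {G : SimpleGraph V} {t : ℕ}
    (ht : indepNum G ≤ t) (S : Finset V) {T : Finset V} (hT : IsIndep G T) :
    (∑ J : Idx G t, if J.1 ⊆ T then (if S ⊆ J.1 then (-1 : ℝ) ^ J.1.card else 0) else 0)
      = if S = T then (-1 : ℝ) ^ T.card else 0 := by
  rw [← sum_neg_one_pow_card_interval]
  have h := Finset.sum_subtype_of_mem
    (s := Finset.univ.filter fun J : Finset V => IsIndep G J ∧ J.card ≤ t)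
    (p := fun J => IsIndep G J ∧ J.card ≤ t)
    (fun J => if S ⊆ J ∧ J ⊆ T then (-1 : ℝ) ^ J.card else 0) (by simp)
  have h2 : (Finset.univ.filter fun J : Finset V => IsIndep G J ∧ J.card ≤ t).subtype
      (fun J => IsIndep G J ∧ J.card ≤ t) = Finset.univ := by
    ext J; simpa using J.2
  rw [h2, Finset.sum_filter] at h
  trans (∑ J : {J : Finset V // IsIndep G J ∧ J.card ≤ t},
    if S ⊆ J.1 ∧ J.1 ⊆ T then (-1 : ℝ) ^ J.1.card else 0)
  · refine Fintype.sum_equiv (Equiv.refl _) _ _ fun J => ?_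
    by_cases h1 : J.1 ⊆ T <;> by_cases h2 : S ⊆ J.1 <;> simp [h1, h2]
  · rw [h]
    refine Finset.sum_congr rfl fun J _ => ?_
    by_cases hJ : J ⊆ T
    · have hJi := hT.mono hJ
      rw [if_pos ⟨hJi, hJi.card_le_indepNum.trans ht⟩]
    · simp [hJ]

theorem upperMobius_nonneg {V : Type*} [Fintype V] {G : SimpleGraph V} {t : ℕ}
    (ht : indepNum G ≤ t) {y : Finset V → ℝ} (hy : (momentMatrix G t y).PosSemidef)
    (S : Finset V) :
    0 ≤ upperMobius (fun K => if IsIndep G K then y K else 0) S := by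
  set z : Finset V → ℝ := fun K => if IsIndep G K then y K else 0 with hz
  have hz0 : ∀ K, ¬ IsIndep G K → z K = 0 := fun K hK => by simp [hz, hK]
  by_cases hS : IsIndep G S
  swap
  · rw [upperMobius_eq_zero hz0 hS]
  let v : Idx G t → ℝ := fun J => if S ⊆ J.1 then (-1 : ℝ) ^ J.1.card else 0
  have hq := hy.dotProduct_mulVec_nonneg v
  have key : star v ⬝ᵥ (momentMatrix G t y *ᵥ v) = ∑ T : Finset V, upperMobius z T *
      ((∑ J : Idx G t, if J.1 ⊆ T then v J else 0) *
        (∑ J : Idx G t, if J.1 ⊆ T then v J else 0)) := by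
    have hM : ∀ J J' : Idx G t, momentMatrix G t y J J'
        = ∑ T : Finset V, if J.1 ∪ J'.1 ⊆ T then upperMobius z T else 0 := fun J J' => by
      rw [sum_upperMobius, momentMatrix_apply ht]
    simp only [dotProduct, Matrix.mulVec, hM, star_trivial, Finset.mul_sum, Finset.sum_mul]
    rw [Finset.sum_congr rfl fun J _ => Finset.sum_comm, Finset.sum_comm]
    refine Finset.sum_congr rfl fun T _ => ?_
    rw [Finset.sum_comm]
    refine Finset.sum_congr rfl fun J _ => Finset.sum_congr rfl fun J' _ => ?_
    by_cases h1 : J.1 ⊆ T <;> by_cases h2 : J'.1 ⊆ T <;>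
      simp [Finset.union_subset_iff, h1, h2]
    ring
  rw [key, Finset.sum_eq_single S] at hq
  · rw [sum_idx_subset ht S hS, if_pos rfl, ← mul_pow] at hq
    simpa using hq
  · intro T _ hTS
    by_cases hT : IsIndep G T
    · rw [sum_idx_subset ht S hT, if_neg (Ne.symm hTS)]
      simp
    · rw [upperMobius_eq_zero hz0 hT, zero_mul]
  · simp

theorem sum_singleton_le_indepNum {V : Type*} [Fintype V] {G : SimpleGraph V} {t : ℕ}
    (ht : indepNum G ≤ t) {y : Finset V → ℝ} (hy0 : y ∅ = 1)
    (hy : (momentMatrix G t y).PosSemidef) : ∑ i : V, y {i} ≤ indepNum G := by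
  set z : Finset V → ℝ := fun K => if IsIndep G K then y K else 0 with hz
  have hnn : ∀ S, 0 ≤ upperMobius z S := upperMobius_nonneg ht hy
  have hone : ∑ T : Finset V, upperMobius z T = 1 := by
    have h := sum_upperMobius z ∅
    simpa [hz, isIndep_empty, hy0] using h
  calc ∑ i : V, y {i}
      = ∑ i : V, ∑ T : Finset V, if i ∈ T then upperMobius z T else 0 := by
        refine Finset.sum_congr rfl fun i _ => ?_
        have h := sum_upperMobius z {i}
        simp only [Finset.singleton_subset_iff] at h
        rw [h]
        simp [hz, isIndep_singleton]
    _ = ∑ T : Finset V, (T.card : ℝ) * upperMobius z T := by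
        rw [Finset.sum_comm]
        simp
    _ ≤ ∑ T : Finset V, (indepNum G : ℝ) * upperMobius z T := by
        refine Finset.sum_le_sum fun T _ => ?_
        by_cases hT : IsIndep G T
        · exact mul_le_mul_of_nonneg_right (by exact_mod_cast hT.card_le_indepNum) (hnn T)
        · rw [upperMobius_eq_zero (fun K hK => by simp [hz, hK]) hT, mul_zero, mul_zero]
    _ = indepNum G := by rw [← Finset.mul_sum, hone, mul_one]

theorem momentMatrix_indicator_posSemidef {V : Type*} [Fintype V] {G : SimpleGraph V} {t : ℕ}
    (ht : indepNum G ≤ t) {I : Finset V} (hI : IsIndep G I) :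
    (momentMatrix G t fun S => if S ⊆ I then 1 else 0).PosSemidef := by
  have h : (momentMatrix G t fun S => if S ⊆ I then 1 else 0) =
      Matrix.vecMulVec (fun J : Idx G t => if J.1 ⊆ I then (1 : ℝ) else 0)
        (star fun J : Idx G t => if J.1 ⊆ I then (1 : ℝ) else 0) := by
    ext J J'
    rw [momentMatrix_apply ht]
    by_cases h : J.1 ∪ J'.1 ⊆ I
    · have h' := Finset.union_subset_iff.1 h
      simp [Matrix.vecMulVec_apply, hI.mono h, h'.1, h'.2, h]
    · have h' := h
      rw [Finset.union_subset_iff] at h'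
      rw [if_neg h, ite_self]
      by_cases h1 : J.1 ⊆ I
      · have h2 : ¬ J'.1 ⊆ I := fun h2 => h' ⟨h1, h2⟩
        simp [Matrix.vecMulVec_apply, h2]
      · simp [Matrix.vecMulVec_apply, h1]
  rw [h]
  exact Matrix.posSemidef_vecMulVec_self_star _

theorem stmt19 {V : Type*} [Fintype V] (G : SimpleGraph V) (t : ℕ)
    (ht : indepNum G ≤ t) : lasserre G t = (indepNum G : ℝ) := by
  refine IsGreatest.csSup_eq ⟨?_, ?_⟩
  · obtain ⟨I, hI, hcard⟩ := exists_isIndep_card_eq_indepNum G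
    refine ⟨fun S => if S ⊆ I then 1 else 0, fun S _ _ => ?_, by simp,
      momentMatrix_indicator_posSemidef ht hI, by simp [hcard]⟩
    dsimp only
    split_ifs <;> norm_num
  · rintro r ⟨y, -, hy0, hy, rfl⟩
    exact sum_singleton_le_indepNum ht hy0 hy
end
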